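/- Let σ : 𝕋 → ℝ be continuous with σ_min := inf_{x∈𝕋} σ(x) > 0, and let u, v be a real-valued classical solution of the Goldstein–Taylor system ∂ₜu + ∂ₓv = 0, ∂ₜv + ∂ₓu = −σ(x)v on 𝕋 × (0,∞) with initial data u₀, v₀; set u_avg := (u₀)_avg. Suppose 0 < α, θ < 2 satisfy: (I) α < θ and θ + α < 2σ_min, and (II) for all x ∈ 𝕋, θ²(σ(x) − α)² − 4(θ − α)(2σ(x) − θ − α) ≤ 0. Then for all t ≥ 0: E_θ(u(·,t) − u_avg, v(·,t)) ≤ E_θ(u₀ − u_avg, v₀) · e^{−αt}. -/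

import Mathlib

open MeasureTheory Real

/-- Average of a (2π-periodic) function over one period. -/
noncomputable def havg (h : ℝ → ℝ) : ℝ := (1 / (2 * π)) * ∫ x in (0:ℝ)..(2 * π), h x

/-- Squared L²(𝕋) norm (normalized). -/
noncomputable def nsq (h : ℝ → ℝ) : ℝ := (1 / (2 * π)) * ∫ x in (0:ℝ)..(2 * π), (h x) ^ 2

/-- The anti-derivative ∂ₓ⁻¹ f with zero average. -/
noncomputable def antider (f : ℝ → ℝ) : ℝ → ℝ := fun x =>
  (∫ y in (0:ℝ)..x, f y) - havg (fun z => ∫ y in (0:ℝ)..z, f y)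

/-- The entropy functional E_θ(f,g). -/
noncomputable def entropyE (θ : ℝ) (f g : ℝ → ℝ) : ℝ :=
  nsq f + nsq g - (θ / (2 * π)) * ∫ x in (0:ℝ)..(2 * π), antider f x * g x

open Set in
theorem hasDerivAt_intervalIntegral_of_continuousOn_deriv {F F' : ℝ → ℝ → ℝ} {S : Set ℝ}
    (hS : IsOpen S) (hF : ∀ s ∈ S, Continuous (F s))
    (hF' : ContinuousOn (Function.uncurry F') (S ×ˢ univ))
    (hd : ∀ s ∈ S, ∀ x, HasDerivAt (fun r => F r x) (F' s x) s) (a b : ℝ) {t : ℝ} (ht : t ∈ S) :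
    HasDerivAt (fun s => ∫ x in a..b, F s x) (∫ x in a..b, F' t x) t := by
  obtain ⟨ε, hε, hball⟩ := Metric.nhds_basis_closedBall.mem_iff.1 (hS.mem_nhds ht)
  have hK : IsCompact (Metric.closedBall t ε ×ˢ uIcc a b) :=
    (isCompact_closedBall t ε).prod isCompact_uIcc
  obtain ⟨C, hC⟩ := hK.exists_bound_of_continuousOn
    (hF'.mono (prod_mono hball (subset_univ _)))
  have hF't : Continuous (F' t) := by
    rw [← continuousOn_univ]
    exact hF'.comp (f := fun x => (t, x)) (by fun_prop) fun x _ => ⟨ht, mem_univ x⟩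
  refine (intervalIntegral.hasDerivAt_integral_of_dominated_loc_of_deriv_le
    (bound := fun _ => C) (Metric.closedBall_mem_nhds t hε) ?_
    ((hF t ht).intervalIntegrable _ _) hF't.aestronglyMeasurable ?_
    intervalIntegrable_const ?_).2
  · filter_upwards [hS.mem_nhds ht] with s hs using (hF s hs).aestronglyMeasurable
  · exact .of_forall fun x hx s hs => hC (s, x) ⟨hs, uIoc_subset_uIcc hx⟩
  · exact .of_forall fun x _ s hs => hd s (hball hs) x

/-- **Wirtinger's inequality** on `[0, 2π]`. -/
theorem integral_sq_le_integral_deriv_sq {f f' : ℝ → ℝ} (hf : ∀ x, HasDerivAt f (f' x) x)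
    (hf' : Continuous f') (hper : f (2 * π) = f 0) (hmean : ∫ x in (0 : ℝ)..(2 * π), f x = 0) :
    ∫ x in (0 : ℝ)..(2 * π), f x ^ 2 ≤ ∫ x in (0 : ℝ)..(2 * π), f' x ^ 2 := by
  have hfc : Continuous f := continuous_iff_continuousAt.2 fun x => (hf x).continuousAt
  have hab : (0 : ℝ) < 2 * π := by positivity
  have hL2 : ∀ g : ℝ → ℝ, Continuous g →
      MemLp (fun x => (g x : ℂ)) 2 (volume.restrict (Set.Ioc 0 (2 * π))) := fun g hg => by
    have hgc : Continuous fun x => (g x : ℂ) := by fun_prop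
    refine (memLp_two_iff_integrable_sq_norm hgc.aestronglyMeasurable).2 ?_
    exact ((hgc.norm.pow 2).integrableOn_Icc).mono_set Set.Ioc_subset_Icc_self
  have h1 := hasSum_sq_fourierCoeffOn hab (hL2 f hfc)
  have h2 := hasSum_sq_fourierCoeffOn hab (hL2 f' hf')
  have hle := hasSum_le (fun n => ?_) h1 h2
  · simp only [Complex.norm_real, Real.norm_eq_abs, sq_abs, smul_eq_mul, sub_zero] at hle
    exact le_of_mul_le_mul_left hle (by positivity)
  rcases eq_or_ne n 0 with rfl | hn
  · have : fourierCoeffOn hab (fun x => (f x : ℂ)) 0 = 0 := by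
      rw [fourierCoeffOn_eq_integral]
      simp [intervalIntegral.integral_ofReal, hmean]
    rw [this]; simp
  · have hc := fourierCoeffOn_of_hasDerivAt hab hn (f := fun x => (f x : ℂ))
      (f' := fun x => (f' x : ℂ)) (fun x _ => (hf x).ofReal_comp)
      ((by fun_prop : Continuous fun x => (f' x : ℂ)).intervalIntegrable _ _)
    have hn1 : (1 : ℝ) ≤ |(n : ℝ)| := by exact_mod_cast Int.one_le_abs hn
    have hnorm : ‖fourierCoeffOn hab (fun x => (f x : ℂ)) n‖ =
        |(n : ℝ)|⁻¹ * ‖fourierCoeffOn hab (fun x => (f' x : ℂ)) n‖ := by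
      rw [hc, hper, sub_self, mul_zero, zero_sub, norm_mul, norm_neg, norm_mul]
      simp [abs_of_pos pi_pos]
      field_simp
    rw [hnorm]
    gcongr
    exact mul_le_of_le_one_left (norm_nonneg _) (inv_le_one_of_one_le₀ hn1)

theorem hasDerivAt_antider {f : ℝ → ℝ} (hf : Continuous f) (x : ℝ) :
    HasDerivAt (antider f) (f x) x :=
  (intervalIntegral.integral_hasDerivAt_right (hf.intervalIntegrable _ _)
    (hf.stronglyMeasurableAtFilter _ _) hf.continuousAt).sub_const _

theorem continuous_antider {f : ℝ → ℝ} (hf : Continuous f) : Continuous (antider f) :=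
  continuous_iff_continuousAt.2 fun x => (hasDerivAt_antider hf x).continuousAt

theorem integral_antider {f : ℝ → ℝ} (hf : Continuous f) :
    ∫ x in (0 : ℝ)..(2 * π), antider f x = 0 := by
  have hc : Continuous fun x => ∫ y in (0 : ℝ)..x, f y :=
    intervalIntegral.continuous_primitive (fun a b => hf.intervalIntegrable a b) 0
  unfold antider
  rw [intervalIntegral.integral_sub (hc.intervalIntegrable _ _) intervalIntegrable_const]
  simp only [havg, intervalIntegral.integral_const, smul_eq_mul]
  field_simp
  ring

theorem antider_two_pi {f : ℝ → ℝ} (hmean : ∫ x in (0 : ℝ)..(2 * π), f x = 0) :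
    antider f (2 * π) = antider f 0 := by
  simp [antider, hmean]

theorem continuous_uncurry_antider {u : ℝ → ℝ → ℝ} (hu : Continuous (Function.uncurry u)) :
    Continuous (Function.uncurry fun t => antider (u t)) := by
  have hG : Continuous (Function.uncurry fun t z => ∫ y in (0 : ℝ)..z, u t y) :=
    intervalIntegral.continuous_parametric_primitive_of_continuous hu
  have hm := (intervalIntegral.continuous_parametric_intervalIntegral_of_continuous'
    (μ := volume) hG 0 (2 * π)).comp (continuous_fst (X := ℝ) (Y := ℝ))
  exact hG.sub (continuous_const.mul hm)

/-- The density of the entropy `entropyE θ f g`. -/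
noncomputable def entropyDensity (θ : ℝ) (f g : ℝ → ℝ) (x : ℝ) : ℝ :=
  f x ^ 2 + g x ^ 2 - θ * (antider f x * g x)

theorem entropyE_eq_integral_entropyDensity (θ : ℝ) {f g : ℝ → ℝ} (hf : Continuous f)
    (hg : Continuous g) :
    entropyE θ f g = (1 / (2 * π)) * ∫ x in (0 : ℝ)..(2 * π), entropyDensity θ f g x := by
  have hA := continuous_antider hf
  simp only [entropyDensity, entropyE, nsq]
  rw [intervalIntegral.integral_sub, intervalIntegral.integral_add,
    intervalIntegral.integral_const_mul]
  · ring
  all_goals exact Continuous.intervalIntegrable (by fun_prop) _ _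

theorem integral_deriv_eq_zero_of_eq {F F' : ℝ → ℝ} (hF : ∀ x, HasDerivAt F (F' x) x)
    (hF' : Continuous F') {a b : ℝ} (hper : F b = F a) : ∫ x in a..b, F' x = 0 := by
  rw [intervalIntegral.integral_eq_sub_of_hasDerivAt (fun x _ => hF x)
    (hF'.intervalIntegrable _ _), hper, sub_self]

/-- The derivative in time of `entropyDensity θ f g` along the Goldstein–Taylor flow, where `f'` and
`g'` are the space derivatives of `f` and `g`. -/
noncomputable def entropyProduction (σ : ℝ → ℝ) (θ : ℝ) (f g f' g' : ℝ → ℝ) (x : ℝ) : ℝ :=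
  2 * f x * -g' x + 2 * g x * (-σ x * g x - f' x) -
    θ * (-(g x - havg g) * g x + antider f x * (-σ x * g x - f' x))

theorem mul_sq_add_le_of_discrim {s α θ : ℝ} (hk : α < θ)
    (h : θ ^ 2 * (s - α) ^ 2 - 4 * (θ - α) * (2 * s - θ - α) ≤ 0) (a g : ℝ) :
    θ * (s - α) * (a * g) ≤ (2 * s - θ - α) * g ^ 2 + (θ - α) * a ^ 2 := by
  have hk' : 0 < 4 * (θ - α) := by linarith
  refine le_of_mul_le_mul_left ?_ hk'
  nlinarith [sq_nonneg (2 * (θ - α) * a - θ * (s - α) * g),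
    mul_nonneg (neg_nonneg.2 h) (sq_nonneg g)]

theorem integral_entropyProduction_le {σ f g f' g' : ℝ → ℝ} {α θ : ℝ} (hσ : Continuous σ)
    (hf : ∀ x, HasDerivAt f (f' x) x) (hg : ∀ x, HasDerivAt g (g' x) x)
    (hf' : Continuous f') (hg' : Continuous g')
    (hfp : f (2 * π) = f 0) (hgp : g (2 * π) = g 0)
    (hmean : ∫ x in (0 : ℝ)..(2 * π), f x = 0) (hθ : 0 < θ) (hαθ : α < θ)
    (hII : ∀ x, θ ^ 2 * (σ x - α) ^ 2 - 4 * (θ - α) * (2 * σ x - θ - α) ≤ 0) :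
    (∫ x in (0 : ℝ)..(2 * π), entropyProduction σ θ f g f' g' x) +
      α * ∫ x in (0 : ℝ)..(2 * π), entropyDensity θ f g x ≤ 0 := by
  have hfc : Continuous f := continuous_iff_continuousAt.2 fun x => (hf x).continuousAt
  have hgc : Continuous g := continuous_iff_continuousAt.2 fun x => (hg x).continuousAt
  have hAc := continuous_antider hfc
  have hA := hasDerivAt_antider hfc
  have hAp := antider_two_pi hmean
  have hpoinc := integral_sq_le_integral_deriv_sq hA hfc hAp (integral_antider hfc)
  have h1 : ∫ x in (0 : ℝ)..(2 * π), (f' x * g x + f x * g' x) = 0 :=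
    integral_deriv_eq_zero_of_eq (fun x => (hf x).mul (hg x)) (by fun_prop) (by simp [hfp, hgp])
  have h2 : ∫ x in (0 : ℝ)..(2 * π), (f x * f x + antider f x * f' x) = 0 :=
    integral_deriv_eq_zero_of_eq (fun x => (hA x).mul (hf x)) (by fun_prop) (by simp [hfp, hAp])
  have hgm : ∫ x in (0 : ℝ)..(2 * π), g x = 2 * π * havg g := by
    rw [havg]; field_simp
  have hle : ∫ x in (0 : ℝ)..(2 * π), (entropyProduction σ θ f g f' g' x +
        α * entropyDensity θ f g x) ≤
      ∫ x in (0 : ℝ)..(2 * π), (-2 * (f' x * g x + f x * g' x)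
        + θ * (f x * f x + antider f x * f' x)
        + (θ - α) * (antider f x ^ 2 - f x ^ 2) - θ * havg g * g x) := by
    refine intervalIntegral.integral_mono (by positivity)
      (Continuous.intervalIntegrable (by unfold entropyProduction entropyDensity; fun_prop) _ _)
      (Continuous.intervalIntegrable (by fun_prop) _ _) fun x => ?_
    have := mul_sq_add_le_of_discrim hαθ (hII x) (antider f x) (g x)
    simp only [entropyProduction, entropyDensity]
    linarith
  rw [intervalIntegral.integral_add, intervalIntegral.integral_const_mul,
    intervalIntegral.integral_sub, intervalIntegral.integral_add, intervalIntegral.integral_add,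
    intervalIntegral.integral_const_mul, intervalIntegral.integral_const_mul,
    intervalIntegral.integral_const_mul, intervalIntegral.integral_const_mul,
    intervalIntegral.integral_sub, h1, h2, hgm] at hle
  · have hk : (θ - α) * ((∫ x in (0 : ℝ)..(2 * π), antider f x ^ 2) -
        ∫ x in (0 : ℝ)..(2 * π), f x ^ 2) ≤ 0 :=
      mul_nonpos_of_nonneg_of_nonpos (by linarith) (by linarith)
    have : 0 ≤ θ * havg g * (2 * π * havg g) := by
      have : θ * havg g * (2 * π * havg g) = θ * (2 * π) * havg g ^ 2 := by ring
      rw [this]; positivity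
    linarith
  all_goals
    exact Continuous.intervalIntegrable
      (by first
        | fun_prop
        | (unfold entropyProduction; fun_prop)
        | (unfold entropyDensity; fun_prop)) _ _

open Set in
/-- A solution of the Goldstein–Taylor system for positive times, continuous up to time `0`, with
`ux` and `vx` the continuous space derivatives of `u` and `v`. -/
structure IsGoldsteinTaylorSolution (σ : ℝ → ℝ) (u v ux vx : ℝ → ℝ → ℝ) : Prop where
  continuous_u : Continuous (Function.uncurry u)
  continuous_v : Continuous (Function.uncurry v)
  periodic_u : ∀ t, Function.Periodic (u t) (2 * π)
  periodic_v : ∀ t, Function.Periodic (v t) (2 * π)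
  continuousOn_ux : ContinuousOn (Function.uncurry ux) (Ioi 0 ×ˢ univ)
  continuousOn_vx : ContinuousOn (Function.uncurry vx) (Ioi 0 ×ˢ univ)
  hasDerivAt_u_space : ∀ t, 0 < t → ∀ x, HasDerivAt (u t) (ux t x) x
  hasDerivAt_v_space : ∀ t, 0 < t → ∀ x, HasDerivAt (v t) (vx t x) x
  hasDerivAt_u_time : ∀ t, 0 < t → ∀ x, HasDerivAt (fun s => u s x) (-vx t x) t
  hasDerivAt_v_time : ∀ t, 0 < t → ∀ x,
    HasDerivAt (fun s => v s x) (-σ x * v t x - ux t x) t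

namespace IsGoldsteinTaylorSolution

variable {σ : ℝ → ℝ} {u v ux vx : ℝ → ℝ → ℝ}

theorem continuous_ux (h : IsGoldsteinTaylorSolution σ u v ux vx) {t : ℝ} (ht : 0 < t) :
    Continuous (ux t) := by
  rw [← continuousOn_univ]
  exact h.continuousOn_ux.comp (f := fun x => (t, x)) (by fun_prop) fun x _ => ⟨ht, Set.mem_univ x⟩

theorem continuous_vx (h : IsGoldsteinTaylorSolution σ u v ux vx) {t : ℝ} (ht : 0 < t) :
    Continuous (vx t) := by
  rw [← continuousOn_univ]
  exact h.continuousOn_vx.comp (f := fun x => (t, x)) (by fun_prop) fun x _ => ⟨ht, Set.mem_univ x⟩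

theorem hasDerivAt_integral_u (h : IsGoldsteinTaylorSolution σ u v ux vx) {t : ℝ} (ht : 0 < t)
    (z : ℝ) : HasDerivAt (fun s => ∫ y in (0 : ℝ)..z, u s y) (-(v t z - v t 0)) t := by
  have := hasDerivAt_intervalIntegral_of_continuousOn_deriv isOpen_Ioi
    (fun s _ => h.continuous_u.uncurry_left s) (F' := fun s x => -vx s x) h.continuousOn_vx.neg
    h.hasDerivAt_u_time 0 z ht
  rwa [intervalIntegral.integral_neg, intervalIntegral.integral_eq_sub_of_hasDerivAt
    (fun x _ => h.hasDerivAt_v_space t ht x)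
    ((h.continuous_vx ht).intervalIntegrable _ _)] at this

theorem hasDerivAt_antider_u (h : IsGoldsteinTaylorSolution σ u v ux vx) {t : ℝ} (ht : 0 < t)
    (x : ℝ) : HasDerivAt (fun s => antider (u s) x) (-(v t x - havg (v t))) t := by
  have hv := h.continuous_v
  have hvt : Continuous (v t) := hv.uncurry_left t
  have hc : Continuous (Function.uncurry fun s z => -(v s z - v s 0)) :=
    (hv.sub (hv.comp (continuous_fst.prodMk continuous_const))).neg
  have := hasDerivAt_intervalIntegral_of_continuousOn_deriv isOpen_Ioi
    (F := fun s z => ∫ y in (0 : ℝ)..z, u s y)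
    (fun s _ => intervalIntegral.continuous_primitive
      (fun a b => (h.continuous_u.uncurry_left s).intervalIntegrable a b) 0)
    hc.continuousOn (fun s hs z => h.hasDerivAt_integral_u hs z) 0 (2 * π) ht
  refine ((h.hasDerivAt_integral_u ht x).sub (this.const_mul (1 / (2 * π)))).congr_deriv ?_
  rw [intervalIntegral.integral_neg, intervalIntegral.integral_sub (hvt.intervalIntegrable _ _)
    intervalIntegrable_const, intervalIntegral.integral_const, havg, smul_eq_mul]
  field_simp
  ring

theorem integral_u_eq (h : IsGoldsteinTaylorSolution σ u v ux vx) {t : ℝ} (ht : 0 ≤ t) :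
    ∫ x in (0 : ℝ)..(2 * π), u t x = ∫ x in (0 : ℝ)..(2 * π), u 0 x := by
  have hc := intervalIntegral.continuous_parametric_intervalIntegral_of_continuous'
    (μ := volume) h.continuous_u 0 (2 * π)
  have hd : ∀ s ∈ Set.Ioo 0 t,
      HasDerivAt (fun s => ∫ x in (0 : ℝ)..(2 * π), u s x) ((fun _ => (0 : ℝ)) s) s := fun s hs => by
    have hp : v s (2 * π) = v s 0 := by simpa using h.periodic_v s 0
    simpa [hp] using h.hasDerivAt_integral_u hs.1 (2 * π)
  have := intervalIntegral.integral_eq_sub_of_hasDerivAt_of_le ht hc.continuousOn hd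
    intervalIntegrable_const
  rw [intervalIntegral.integral_zero] at this
  linarith

theorem continuous_integral_entropyDensity (h : IsGoldsteinTaylorSolution σ u v ux vx) (θ : ℝ) :
    Continuous fun t => ∫ x in (0 : ℝ)..(2 * π), entropyDensity θ (u t) (v t) x := by
  refine intervalIntegral.continuous_parametric_intervalIntegral_of_continuous' ?_ 0 (2 * π)
  exact ((h.continuous_u.pow 2).add (h.continuous_v.pow 2)).sub
    (continuous_const.mul ((continuous_uncurry_antider h.continuous_u).mul h.continuous_v))

theorem hasDerivAt_integral_entropyDensity (h : IsGoldsteinTaylorSolution σ u v ux vx)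
    (hσ : Continuous σ) (θ : ℝ) {t : ℝ} (ht : 0 < t) :
    HasDerivAt (fun s => ∫ x in (0 : ℝ)..(2 * π), entropyDensity θ (u s) (v s) x)
      (∫ x in (0 : ℝ)..(2 * π), entropyProduction σ θ (u t) (v t) (ux t) (vx t) x) t := by
  have hu := h.continuous_u
  have hv := h.continuous_v
  have hA := continuous_uncurry_antider hu
  refine hasDerivAt_intervalIntegral_of_continuousOn_deriv (S := Set.Ioi 0) isOpen_Ioi
    (F' := fun s x => entropyProduction σ θ (u s) (v s) (ux s) (vx s) x)
    (fun s _ => ?_) ?_ (fun s hs x => ?_) 0 (2 * π) ht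
  · have hA' := continuous_antider (hu.uncurry_left s)
    exact (((hu.uncurry_left s).pow 2).add ((hv.uncurry_left s).pow 2)).sub
      (continuous_const.mul (hA'.mul (hv.uncurry_left s)))
  · have hm : Continuous fun p : ℝ × ℝ => havg (v p.1) :=
      continuous_const.mul ((intervalIntegral.continuous_parametric_intervalIntegral_of_continuous'
        (μ := volume) hv 0 (2 * π)).comp continuous_fst)
    have hs : Continuous fun p : ℝ × ℝ => σ p.2 := by fun_prop
    have hvt := (hs.neg.mul hv).continuousOn.sub h.continuousOn_ux
    exact (((continuous_const.mul hu).continuousOn.mul h.continuousOn_vx.neg).add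
      ((continuous_const.mul hv).continuousOn.mul hvt)).sub
      (continuousOn_const.mul (((hv.sub hm).neg.mul hv).continuousOn.add
        (hA.continuousOn.mul hvt)))
  · have h1 := h.hasDerivAt_u_time s hs x
    have h2 := h.hasDerivAt_v_time s hs x
    refine (((h1.pow 2).add (h2.pow 2)).sub
      (((h.hasDerivAt_antider_u hs x).mul h2).const_mul θ)).congr_deriv ?_
    simp only [entropyProduction]
    push_cast
    ring

theorem entropyE_le (h : IsGoldsteinTaylorSolution σ u v ux vx) (hσ : Continuous σ)
    (hmean : ∫ x in (0 : ℝ)..(2 * π), u 0 x = 0) {α θ : ℝ} (hθ : 0 < θ) (hαθ : α < θ)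
    (hII : ∀ x, θ ^ 2 * (σ x - α) ^ 2 - 4 * (θ - α) * (2 * σ x - θ - α) ≤ 0)
    {t : ℝ} (ht : 0 ≤ t) :
    entropyE θ (u t) (v t) ≤ entropyE θ (u 0) (v 0) * Real.exp (-α * t) := by
  have hd : ∀ s, 0 < s → HasDerivAt (fun s =>
      (∫ x in (0 : ℝ)..(2 * π), entropyDensity θ (u s) (v s) x) * Real.exp (α * s)) _ s :=
    fun s hs => (h.hasDerivAt_integral_entropyDensity hσ θ hs).mul
      ((hasDerivAt_id s).const_mul α).exp
  have hanti : AntitoneOn (fun s =>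
      (∫ x in (0 : ℝ)..(2 * π), entropyDensity θ (u s) (v s) x) * Real.exp (α * s))
      (Set.Ici 0) := by
    refine antitoneOn_of_deriv_nonpos (convex_Ici 0)
      ((h.continuous_integral_entropyDensity θ).mul (by fun_prop)).continuousOn ?_ ?_ <;>
    rw [interior_Ici]
    · exact fun s hs => (hd s hs).differentiableAt.differentiableWithinAt
    · intro s hs
      have hmean_s := (h.integral_u_eq (le_of_lt hs)).trans hmean
      have key := integral_entropyProduction_le hσ (h.hasDerivAt_u_space s hs)
        (h.hasDerivAt_v_space s hs) (h.continuous_ux hs) (h.continuous_vx hs)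
        (by simpa using h.periodic_u s 0) (by simpa using h.periodic_v s 0) hmean_s hθ hαθ hII
      rw [(hd s hs).deriv]
      have := mul_nonpos_of_nonpos_of_nonneg key (Real.exp_pos (α * s)).le
      simp only [id]
      linarith
  have hle := hanti (Set.mem_Ici.2 le_rfl) (Set.mem_Ici.2 ht) ht
  simp only [mul_zero, Real.exp_zero, mul_one] at hle
  rw [entropyE_eq_integral_entropyDensity θ (h.continuous_u.uncurry_left t)
      (h.continuous_v.uncurry_left t),
    entropyE_eq_integral_entropyDensity θ (h.continuous_u.uncurry_left 0)
      (h.continuous_v.uncurry_left 0), mul_assoc, neg_mul, Real.exp_neg, ← div_eq_mul_inv]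
  gcongr
  rwa [le_div_iff₀ (Real.exp_pos _)]

end IsGoldsteinTaylorSolution

section PartialDerivatives

variable {w : ℝ → ℝ → ℝ}

theorem continuous_uncurry_max_zero
    (hw : ContinuousOn (Function.uncurry w) (Set.Ici (0 : ℝ) ×ˢ Set.univ)) :
    Continuous (Function.uncurry fun s x => w (max s 0) x) := by
  rw [← continuousOn_univ]
  exact hw.comp (f := fun p : ℝ × ℝ => (max p.1 0, p.2)) (by fun_prop)
    fun p _ => ⟨le_max_right p.1 0, Set.mem_univ _⟩

theorem hasFDerivAt_uncurry_of_contDiffOn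
    (hw : ContDiffOn ℝ 1 (Function.uncurry w) (Set.Ici (0 : ℝ) ×ˢ Set.univ)) {t : ℝ}
    (ht : 0 < t) (x : ℝ) :
    HasFDerivAt (Function.uncurry w) (fderiv ℝ (Function.uncurry w) (t, x)) (t, x) :=
  ((hw.contDiffAt (prod_mem_nhds (Ici_mem_nhds ht) Filter.univ_mem)).differentiableAt
    one_ne_zero).hasFDerivAt

theorem hasDerivAt_space_of_contDiffOn
    (hw : ContDiffOn ℝ 1 (Function.uncurry w) (Set.Ici (0 : ℝ) ×ˢ Set.univ)) {t : ℝ}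
    (ht : 0 < t) (x : ℝ) :
    HasDerivAt (w t) (fderiv ℝ (Function.uncurry w) (t, x) (0, 1)) x :=
  (hasFDerivAt_uncurry_of_contDiffOn hw ht x).comp_hasDerivAt x
    ((hasDerivAt_const x t).prodMk (hasDerivAt_id x))

theorem hasDerivAt_time_of_contDiffOn
    (hw : ContDiffOn ℝ 1 (Function.uncurry w) (Set.Ici (0 : ℝ) ×ˢ Set.univ)) {t : ℝ}
    (ht : 0 < t) (x : ℝ) :
    HasDerivAt (fun s => w s x) (deriv (fun s => w s x) t) t :=
  have h : HasDerivAt (fun s => w s x) (fderiv ℝ (Function.uncurry w) (t, x) (1, 0)) t :=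
    (hasFDerivAt_uncurry_of_contDiffOn hw ht x).comp_hasDerivAt (f := fun s => (s, x)) t
      ((hasDerivAt_id' t).prodMk (hasDerivAt_const t x))
  h.differentiableAt.hasDerivAt

theorem continuousOn_deriv_space_of_contDiffOn
    (hw : ContDiffOn ℝ 1 (Function.uncurry w) (Set.Ici (0 : ℝ) ×ˢ Set.univ)) :
    ContinuousOn (Function.uncurry fun t x => deriv (w t) x) (Set.Ioi (0 : ℝ) ×ˢ Set.univ) := by
  have hc := (hw.mono
    (Set.prod_mono Set.Ioi_subset_Ici_self subset_rfl)).continuousOn_fderiv_of_isOpen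
    (isOpen_Ioi.prod isOpen_univ) le_rfl
  exact (hc.clm_apply (continuousOn_const (c := ((0 : ℝ), (1 : ℝ))))).congr
    fun p hp => (hasDerivAt_space_of_contDiffOn hw hp.1 p.2).deriv

end PartialDerivatives

theorem isGoldsteinTaylorSolution_of_contDiffOn {σ : ℝ → ℝ} {u v : ℝ → ℝ → ℝ}
    (huC : ContDiffOn ℝ 1 (Function.uncurry u) (Set.Ici (0:ℝ) ×ˢ Set.univ))
    (hvC : ContDiffOn ℝ 1 (Function.uncurry v) (Set.Ici (0:ℝ) ×ˢ Set.univ))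
    (hup : ∀ t, Function.Periodic (u t) (2 * π))
    (hvp : ∀ t, Function.Periodic (v t) (2 * π))
    (hpde1 : ∀ t, 0 < t → ∀ x, deriv (fun s => u s x) t + deriv (fun y => v t y) x = 0)
    (hpde2 : ∀ t, 0 < t → ∀ x,
      deriv (fun s => v s x) t + deriv (fun y => u t y) x = -σ x * v t x) (c : ℝ) :
    IsGoldsteinTaylorSolution σ (fun t x => u (max t 0) x - c) (fun t => v (max t 0))
      (fun t x => deriv (u t) x) (fun t x => deriv (v t) x) where
  continuous_u := (continuous_uncurry_max_zero huC.continuousOn).sub continuous_const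
  continuous_v := continuous_uncurry_max_zero hvC.continuousOn
  periodic_u t x := by simp only [hup (max t 0) x]
  periodic_v t := hvp _
  continuousOn_ux := continuousOn_deriv_space_of_contDiffOn huC
  continuousOn_vx := continuousOn_deriv_space_of_contDiffOn hvC
  hasDerivAt_u_space t ht x := by
    rw [max_eq_left ht.le]
    exact (hasDerivAt_space_of_contDiffOn huC ht x).differentiableAt.hasDerivAt.sub_const c
  hasDerivAt_v_space t ht x := by
    rw [max_eq_left ht.le]
    exact (hasDerivAt_space_of_contDiffOn hvC ht x).differentiableAt.hasDerivAt
  hasDerivAt_u_time t ht x := by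
    have h := (hasDerivAt_time_of_contDiffOn huC ht x).sub_const c
    rw [eq_neg_of_add_eq_zero_left (hpde1 t ht x)] at h
    refine h.congr_of_eventuallyEq ?_
    filter_upwards [Ioi_mem_nhds ht] with s hs
    rw [max_eq_left (le_of_lt hs)]
  hasDerivAt_v_time t ht x := by
    have h := hasDerivAt_time_of_contDiffOn hvC ht x
    rw [eq_sub_of_add_eq (hpde2 t ht x)] at h
    rw [max_eq_left ht.le]
    refine h.congr_of_eventuallyEq ?_
    filter_upwards [Ioi_mem_nhds ht] with s hs
    rw [max_eq_left (le_of_lt hs)]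

/-- Theorem 5.1: entropy decay under the perturbative conditions (I) and (II). -/
theorem gt_perturbative_entropy_decay
    (σ : ℝ → ℝ) (hσc : Continuous σ) (hσp : Function.Periodic σ (2 * π))
    (hmin : 0 < sInf (Set.range σ))
    (u v : ℝ → ℝ → ℝ) (u₀ v₀ : ℝ → ℝ)
    (huC : ContDiffOn ℝ 1 (Function.uncurry u) (Set.Ici (0:ℝ) ×ˢ Set.univ))
    (hvC : ContDiffOn ℝ 1 (Function.uncurry v) (Set.Ici (0:ℝ) ×ˢ Set.univ))
    (hup : ∀ t, Function.Periodic (u t) (2 * π))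
    (hvp : ∀ t, Function.Periodic (v t) (2 * π))
    (hpde1 : ∀ t, 0 < t → ∀ x, deriv (fun s => u s x) t + deriv (fun y => v t y) x = 0)
    (hpde2 : ∀ t, 0 < t → ∀ x,
      deriv (fun s => v s x) t + deriv (fun y => u t y) x = -σ x * v t x)
    (hu0 : ∀ x, u 0 x = u₀ x) (hv0 : ∀ x, v 0 x = v₀ x)
    (α θ : ℝ) (hα0 : 0 < α) (hα2 : α < 2) (hθ0 : 0 < θ) (hθ2 : θ < 2)
    (hI₁ : α < θ) (hI₂ : θ + α < 2 * sInf (Set.range σ))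
    (hII : ∀ x, θ ^ 2 * (σ x - α) ^ 2 - 4 * (θ - α) * (2 * σ x - θ - α) ≤ 0) :
    ∀ t, 0 ≤ t →
      entropyE θ (fun x => u t x - havg u₀) (v t) ≤
        entropyE θ (fun x => u₀ x - havg u₀) v₀ * Real.exp (-α * t) := by
  intro t ht
  obtain rfl : u 0 = u₀ := funext hu0
  obtain rfl : v 0 = v₀ := funext hv0
  have h := isGoldsteinTaylorSolution_of_contDiffOn huC hvC hup hvp hpde1 hpde2 (havg (u 0))
  have hu0c : Continuous (u 0) := by
    simpa using (continuous_uncurry_max_zero huC.continuousOn).uncurry_left 0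
  have hmean : ∫ x in (0 : ℝ)..(2 * π), (u (max 0 0) x - havg (u 0)) = 0 := by
    rw [max_self, intervalIntegral.integral_sub (hu0c.intervalIntegrable _ _)
      intervalIntegrable_const, intervalIntegral.integral_const, havg, smul_eq_mul]
    field_simp
    ring
  simpa only [max_eq_left ht, max_self] using h.entropyE_le hσc hmean hθ0 hI₁ hII ht
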